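/- For every non-negative integer n, \(64 \sum_{k=0}^{n} \binom{2n}{n+k} P_{k}^{4} = 6^{2n} - (-1)^{n} \cdot 2^{2n+2} + 3 \cdot 2^{2n}\). -/

import Mathlib

/-- The Pell numbers: `P 0 = 0`, `P 1 = 1`, `P (n+2) = 2 P (n+1) + P n`. -/
def pellNum : ℕ → ℕ
  | 0 => 0
  | 1 => 1
  | n + 2 => 2 * pellNum (n + 1) + pellNum n

open Finset in
/-- Folding the binomial expansion of `(1 + x) ^ (2 * n)` about its central term. -/
theorem sum_choose_mul_pow_add_pow {R : Type*} [CommRing R] {x y : R} (h : x * y = 1) (n : ℕ) :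
    ∑ k ∈ range (n + 1), (Nat.choose (2 * n) (n + k) : R) * (x ^ k + y ^ k) =
      (x + 2 + y) ^ n + Nat.choose (2 * n) n := by
  have hexp : (x + 2 + y) ^ n =
      ∑ j ∈ range (n + (n + 1)), (Nat.choose (2 * n) j : R) * (x ^ j * y ^ n) := by
    have hb : x + 2 + y = (x + 1) ^ 2 * y := by linear_combination (-x - 2) * h
    rw [hb, mul_pow, ← pow_mul, add_pow, sum_mul, show n + (n + 1) = 2 * n + 1 by ring]
    refine sum_congr rfl fun j _ => ?_
    rw [one_pow]
    ring
  have hupper : ∑ k ∈ range (n + 1), (Nat.choose (2 * n) (n + k) : R) * (x ^ (n + k) * y ^ n) =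
      ∑ k ∈ range (n + 1), (Nat.choose (2 * n) (n + k) : R) * x ^ k := by
    refine sum_congr rfl fun k _ => ?_
    rw [pow_add, mul_right_comm, ← mul_pow, h, one_pow, one_mul]
  have hlower : ∑ j ∈ range n, (Nat.choose (2 * n) j : R) * (x ^ j * y ^ n) =
      ∑ k ∈ range n, (Nat.choose (2 * n) (n + (k + 1)) : R) * y ^ (k + 1) := by
    rw [← sum_range_reflect]
    refine sum_congr rfl fun k hk => ?_
    obtain ⟨m, rfl⟩ := Nat.exists_eq_add_of_lt (mem_range.mp hk)
    rw [show k + m + 1 - 1 - k = m by omega,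
      Nat.choose_symm_of_eq_add (show 2 * (k + m + 1) = m + (k + m + 1 + (k + 1)) by ring),
      show k + m + 1 = m + (k + 1) by ring, pow_add y m, ← mul_assoc (x ^ m), ← mul_pow, h,
      one_pow, one_mul]
  simp only [mul_add, sum_add_distrib]
  rw [hexp, sum_range_add _ n (n + 1), hupper, hlower,
    sum_range_succ' (fun k => (Nat.choose (2 * n) (n + k) : R) * y ^ k)]
  simp only [add_zero, pow_zero, mul_one]
  ring

/-- Binet's formula for the Pell numbers. -/
theorem two_mul_sqrt_two_mul_pellNum (k : ℕ) :
    2 * √2 * (pellNum k : ℝ) = (1 + √2) ^ k - (1 - √2) ^ k := by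
  have h2 : √2 ^ 2 = (2 : ℝ) := Real.sq_sqrt (by norm_num)
  induction k using Nat.twoStepInduction with
  | zero => simp [pellNum]
  | one => simp [pellNum]; ring
  | more k ih0 ih1 =>
    rw [pellNum]
    push_cast
    linear_combination 2 * ih1 + ih0 - ((1 + √2) ^ k - (1 - √2) ^ k) * h2

theorem sixty_four_mul_pellNum_pow_four (k : ℕ) :
    64 * (pellNum k : ℝ) ^ 4 =
      (((1 + √2) ^ 4) ^ k + ((1 - √2) ^ 4) ^ k)
        - 4 * ((-(1 + √2) ^ 2) ^ k + (-(1 - √2) ^ 2) ^ k) + 3 * (1 ^ k + 1 ^ k) := by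
  have h2 : √2 ^ 2 = (2 : ℝ) := Real.sq_sqrt (by norm_num)
  have hab : (1 + √2) * (1 - √2) = -1 := by linear_combination -h2
  have hA : -(1 + √2) ^ 2 = (1 + √2) * (1 - √2) * (1 + √2) ^ 2 := by rw [hab]; ring
  have hB : -(1 - √2) ^ 2 = (1 + √2) * (1 - √2) * (1 - √2) ^ 2 := by rw [hab]; ring
  have hC : (1 : ℝ) = ((1 + √2) * (1 - √2)) ^ 2 := by rw [hab]; ring
  have hC' : (1 : ℝ) ^ k = (((1 + √2) * (1 - √2)) ^ 2) ^ k := by rw [← hC]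
  have h64 : (64 : ℝ) * (pellNum k : ℝ) ^ 4 = (2 * √2 * (pellNum k : ℝ)) ^ 4 := by
    linear_combination (-16 * (pellNum k : ℝ) ^ 4 * (√2 ^ 2 + 2)) * h2
  rw [h64, two_mul_sqrt_two_mul_pellNum, hA, hB, hC']
  simp only [mul_pow, ← pow_mul, mul_comm _ k]
  simp only [pow_mul]
  ring

/-- For every non-negative integer `n`,
`64 ∑_{k=0}^n C(2n, n+k) P_k⁴ = 6^{2n} - (-1)^n·2^{2n+2} + 3·2^{2n}` (as integers). -/
theorem sum_choose_pell_fourth (n : ℕ) :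
    64 * ∑ k ∈ Finset.range (n + 1),
        ((Nat.choose (2 * n) (n + k) : ℤ) * (pellNum k : ℤ) ^ 4) =
      6 ^ (2 * n) - (-1) ^ n * 2 ^ (2 * n + 2) + 3 * 2 ^ (2 * n) := by
  have h2 : √2 ^ 2 = (2 : ℝ) := Real.sq_sqrt (by norm_num)
  have h4 : √2 ^ 4 = (4 : ℝ) := by linear_combination (√2 ^ 2 + 2) * h2
  have hfour := sum_choose_mul_pow_add_pow (x := (1 + √2) ^ 4) (y := (1 - √2) ^ 4)
    (by rw [← mul_pow, show (1 + √2) * (1 - √2) = -1 by linear_combination -h2]; norm_num) n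
  have htwo := sum_choose_mul_pow_add_pow (x := -(1 + √2) ^ 2) (y := -(1 - √2) ^ 2)
    (by rw [neg_mul_neg, ← mul_pow, show (1 + √2) * (1 - √2) = -1 by linear_combination -h2]
        norm_num) n
  have hone := sum_choose_mul_pow_add_pow (x := (1 : ℝ)) (y := 1) (one_mul 1) n
  rw [show (1 + √2) ^ 4 + 2 + (1 - √2) ^ 4 = (36 : ℝ) by
    linear_combination 12 * h2 + 2 * h4] at hfour
  rw [show -(1 + √2) ^ 2 + 2 + -(1 - √2) ^ 2 = (-1 * 4 : ℝ) by
    linear_combination -2 * h2, mul_pow] at htwo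
  rw [show (1 : ℝ) + 2 + 1 = 4 by norm_num] at hone
  have hsum : 64 * ∑ k ∈ Finset.range (n + 1),
      ((Nat.choose (2 * n) (n + k) : ℝ) * (pellNum k : ℝ) ^ 4) =
      36 ^ n - 4 * ((-1) ^ n * 4 ^ n) + 3 * 4 ^ n := by
    have hsplit : 64 * ∑ k ∈ Finset.range (n + 1),
        ((Nat.choose (2 * n) (n + k) : ℝ) * (pellNum k : ℝ) ^ 4) = _ :=
      (Finset.mul_sum _ _ _).trans <| Finset.sum_congr rfl fun k _ => by
        rw [mul_left_comm, sixty_four_mul_pellNum_pow_four, mul_add, mul_sub,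
          mul_left_comm _ (4 : ℝ), mul_left_comm _ (3 : ℝ)]
    rw [hsplit, Finset.sum_add_distrib, Finset.sum_sub_distrib, ← Finset.mul_sum,
      ← Finset.mul_sum, hfour, htwo, hone]
    ring
  have h36 : (6 : ℤ) ^ (2 * n) = 36 ^ n := by rw [pow_mul]; norm_num
  have hpow : (2 : ℤ) ^ (2 * n) = 4 ^ n := by rw [pow_mul]; norm_num
  rw [pow_add, h36, hpow]
  have hint : 64 * ∑ k ∈ Finset.range (n + 1),
      ((Nat.choose (2 * n) (n + k) : ℤ) * (pellNum k : ℤ) ^ 4) =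
      36 ^ n - 4 * ((-1) ^ n * 4 ^ n) + 3 * 4 ^ n := by exact_mod_cast hsum
  rw [hint]
  ring
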